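/- arXiv:2301.05655 — 5 statements merged into one kernel-verified Lean document; each statement's English description precedes it below -/
import Mathlib

section
/- Let 𝒫 be a nonempty set of (countably additive) probability measures on a measurable space (Ω, ℱ), let A ∈ ℱ, and let {E_i}_{i∈I} be a countable measurable partition of Ω such that P(E_i) > 0 for every P ∈ 𝒫 and every i ∈ I. If the set {P(A) : P ∈ 𝒫} is closed in ℝ, then ⨅_{i∈I} ⨅_{P∈𝒫} P(A|E_i) ≤ P̲(A) and ⨆_{i∈I} ⨆_{P∈𝒫} P(A|E_i) ≥ P̄(A). In particular, generalized Bayes' updating on the experiment {E_i} does not weakly uniformly constrict A. -/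
open MeasureTheory

/-- The conditional probability `P(A | E) = P(A ∩ E) / P(E)` as a real number. -/
noncomputable def condProb {Ω : Type*} [MeasurableSpace Ω]
    (P : MeasureTheory.Measure Ω) (A E : Set Ω) : ℝ :=
  (P (A ∩ E)).toReal / (P E).toReal

/-- The lower probability of `A` for a set of probability measures `Ps`. -/
noncomputable def lowerProb {Ω : Type*} [MeasurableSpace Ω]
    (Ps : Set (MeasureTheory.Measure Ω)) (A : Set Ω) : ℝ :=
  ⨅ P : Ps, (P.1 A).toReal

/-- The upper probability of `A` for a set of probability measures `Ps`. -/
noncomputable def upperProb {Ω : Type*} [MeasurableSpace Ω]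
    (Ps : Set (MeasureTheory.Measure Ω)) (A : Set Ω) : ℝ :=
  ⨆ P : Ps, (P.1 A).toReal

theorem condProb_nonneg {Ω : Type*} [MeasurableSpace Ω] (P : Measure Ω) (A E : Set Ω) :
    0 ≤ condProb P A E :=
  div_nonneg ENNReal.toReal_nonneg ENNReal.toReal_nonneg

theorem condProb_le_one {Ω : Type*} [MeasurableSpace Ω] (P : Measure Ω) [IsFiniteMeasure P]
    (A E : Set Ω) : condProb P A E ≤ 1 :=
  div_le_one_of_le₀ (measureReal_mono Set.inter_subset_right) ENNReal.toReal_nonneg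

section Partition

variable {Ω : Type*} [MeasurableSpace Ω] {P : Measure Ω} {A : Set Ω}
  {I : Type*} [Countable I] {E : I → Set Ω}

/-- A finite measure of a set is the sum over a countable partition of its pieces. -/
theorem hasSum_measure_inter_toReal [IsFiniteMeasure P] (hA : MeasurableSet A)
    (hE : ∀ i, MeasurableSet (E i)) (hdisj : Pairwise (Function.onFun Disjoint E))
    (hcover : (⋃ i, E i) = Set.univ) :
    HasSum (fun i => (P (A ∩ E i)).toReal) (P A).toReal := by
  have h : P A = ∑' i, P (A ∩ E i) := by
    rw [← measure_iUnion (fun i j hij => (hdisj hij).mono Set.inter_subset_right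
      Set.inter_subset_right) (fun i => hA.inter (hE i)), ← Set.inter_iUnion, hcover,
      Set.inter_univ]
  have hfin : ∑' i, P (A ∩ E i) ≠ ⊤ := h ▸ measure_ne_top P A
  rw [h, ENNReal.tsum_toReal_eq fun i => measure_ne_top P _]
  exact ENNReal.hasSum_toReal hfin

variable [IsProbabilityMeasure P]

theorem hasSum_mul_measure_toReal (hE : ∀ i, MeasurableSet (E i))
    (hdisj : Pairwise (Function.onFun Disjoint E)) (hcover : (⋃ i, E i) = Set.univ) (c : ℝ) :
    HasSum (fun i => c * (P (E i)).toReal) c := by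
  simpa using (hasSum_measure_inter_toReal (P := P) .univ hE hdisj hcover).mul_left c

/-- A lower bound for all conditional probabilities over a partition bounds the probability. -/
theorem le_measure_toReal_of_le_condProb (hA : MeasurableSet A)
    (hE : ∀ i, MeasurableSet (E i)) (hdisj : Pairwise (Function.onFun Disjoint E))
    (hcover : (⋃ i, E i) = Set.univ) (hpos : ∀ i, 0 < P (E i)) {c : ℝ}
    (hc : ∀ i, c ≤ condProb P A (E i)) : c ≤ (P A).toReal :=
  hasSum_le (fun i => (le_div_iff₀ (ENNReal.toReal_pos (hpos i).ne' (measure_ne_top P _))).1 (hc i))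
    (hasSum_mul_measure_toReal hE hdisj hcover c) (hasSum_measure_inter_toReal hA hE hdisj hcover)

/-- An upper bound for all conditional probabilities over a partition bounds the probability. -/
theorem measure_toReal_le_of_condProb_le (hA : MeasurableSet A)
    (hE : ∀ i, MeasurableSet (E i)) (hdisj : Pairwise (Function.onFun Disjoint E))
    (hcover : (⋃ i, E i) = Set.univ) (hpos : ∀ i, 0 < P (E i)) {c : ℝ}
    (hc : ∀ i, condProb P A (E i) ≤ c) : (P A).toReal ≤ c :=
  hasSum_le (fun i => (div_le_iff₀ (ENNReal.toReal_pos (hpos i).ne' (measure_ne_top P _))).1 (hc i))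
    (hasSum_measure_inter_toReal hA hE hdisj hcover) (hasSum_mul_measure_toReal hE hdisj hcover c)

end Partition

/-- if `{P A : P ∈ Ps}` is closed in `ℝ`, then the overall infimum of the
conditional probabilities of `A` over a countable measurable partition is at most the lower
probability of `A`, the overall supremum is at least the upper probability of `A`; in
particular generalized Bayes' updating on the experiment does not weakly uniformly
constrict `A`. -/
theorem no_weak_uniform_constriction_of_isClosed {Ω : Type*} [MeasurableSpace Ω]
    (Ps : Set (Measure Ω)) (hPsne : Ps.Nonempty)
    (hPsprob : ∀ P ∈ Ps, IsProbabilityMeasure P)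
    {A : Set Ω} (hA : MeasurableSet A)
    {I : Type*} [Countable I] (E : I → Set Ω)
    (hEmeas : ∀ i, MeasurableSet (E i))
    (hEdisj : Pairwise (Function.onFun Disjoint E))
    (hEcover : (⋃ i, E i) = Set.univ)
    (hEpos : ∀ P ∈ Ps, ∀ i, 0 < P (E i))
    (hclosed : IsClosed {x : ℝ | ∃ P ∈ Ps, (P A).toReal = x}) :
    ((⨅ i, ⨅ P : Ps, condProb P.1 A (E i)) ≤ lowerProb Ps A ∧
      upperProb Ps A ≤ ⨆ i, ⨆ P : Ps, condProb P.1 A (E i)) ∧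
    ¬ (lowerProb Ps A ≤ (⨅ i, ⨅ P : Ps, condProb P.1 A (E i)) ∧
        (⨆ i, ⨆ P : Ps, condProb P.1 A (E i)) ≤ upperProb Ps A ∧
        (lowerProb Ps A < (⨅ i, ⨅ P : Ps, condProb P.1 A (E i)) ∨
          (⨆ i, ⨆ P : Ps, condProb P.1 A (E i)) < upperProb Ps A)) := by
  have : Nonempty Ps := hPsne.to_subtype
  have hprob (P : Ps) : IsProbabilityMeasure P.1 := hPsprob P.1 P.2
  have hlower : (⨅ i, ⨅ P : Ps, condProb P.1 A (E i)) ≤ lowerProb Ps A := by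
    refine le_ciInf fun P => le_measure_toReal_of_le_condProb hA hEmeas hEdisj hEcover
      (hEpos P.1 P.2) fun i => ?_
    refine (ciInf_le ⟨0, ?_⟩ i).trans (ciInf_le ⟨0, ?_⟩ P)
    · rintro _ ⟨j, rfl⟩
      exact Real.iInf_nonneg fun Q => condProb_nonneg Q.1 A (E j)
    · rintro _ ⟨Q, rfl⟩
      exact condProb_nonneg Q.1 A (E i)
  have hupper : upperProb Ps A ≤ ⨆ i, ⨆ P : Ps, condProb P.1 A (E i) := by
    refine ciSup_le fun P => measure_toReal_le_of_condProb_le hA hEmeas hEdisj hEcover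
      (hEpos P.1 P.2) fun i => ?_
    refine (le_ciSup (f := fun Q : Ps => condProb Q.1 A (E i)) ⟨1, ?_⟩ P).trans
      (le_ciSup (f := fun j => ⨆ Q : Ps, condProb Q.1 A (E j)) ⟨1, ?_⟩ i)
    · rintro _ ⟨Q, rfl⟩
      exact condProb_le_one Q.1 A (E i)
    · rintro _ ⟨j, rfl⟩
      exact ciSup_le fun Q => condProb_le_one Q.1 A (E j)
  exact ⟨⟨hlower, hupper⟩, fun h => h.2.2.elim hlower.not_gt hupper.not_gt⟩
end

section
/- Let 𝒫 be a nonempty set of probability measures on a measurable space (Ω, ℱ), let A ∈ ℱ, and let ℰ be a countable measurable partition of Ω with P(E) > 0 for every P ∈ 𝒫 and every E ∈ ℰ. Suppose there exist P₀, P₁ ∈ 𝒫 with P₀(A) = P̲(A) and P₁(A) = P̄(A). Then it is NOT the case that for every E ∈ ℰ: ⨅_{P∈𝒫} P(A|E) ≥ P̲(A) and ⨆_{P∈𝒫} P(A|E) ≤ P̄(A) and (⨅_{P∈𝒫} P(A|E) > P̲(A) or ⨆_{P∈𝒫} P(A|E) < P̄(A)). That is, there exists E ∈ ℰ such that generalized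 Bayes' updating on E does not weakly constrict A. -/
open MeasureTheory

section Partition

variable {Ω I : Type*} [MeasurableSpace Ω] [Countable I] {E : I → Set Ω}

/-- Additivity over a countable measurable partition, in real-valued form. -/
theorem hasSum_toReal_measure_inter_partition (P : Measure Ω) [IsFiniteMeasure P]
    {A : Set Ω} (hA : MeasurableSet A) (hEmeas : ∀ i, MeasurableSet (E i))
    (hEdisj : Pairwise (Function.onFun Disjoint E)) (hEcover : (⋃ i, E i) = Set.univ) :
    HasSum (fun i => (P (A ∩ E i)).toReal) (P A).toReal := by
  have hsum : P A = ∑' i, P (A ∩ E i) := by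
    rw [← measure_iUnion
      (fun i j hij => (hEdisj hij).mono Set.inter_subset_right Set.inter_subset_right)
      (fun i => hA.inter (hEmeas i)), ← Set.inter_iUnion, hEcover, Set.inter_univ]
  rw [hsum, ENNReal.tsum_toReal_eq fun i => measure_ne_top P _]
  exact (ENNReal.summable_toReal (hsum ▸ measure_ne_top P A)).hasSum

theorem hasSum_mul_toReal_measure_partition (P : Measure Ω) [IsProbabilityMeasure P]
    (hEmeas : ∀ i, MeasurableSet (E i)) (hEdisj : Pairwise (Function.onFun Disjoint E))
    (hEcover : (⋃ i, E i) = Set.univ) (c : ℝ) :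
    HasSum (fun i => c * (P (E i)).toReal) c := by
  simpa using (hasSum_toReal_measure_inter_partition P MeasurableSet.univ
    hEmeas hEdisj hEcover).mul_left c

theorem condProb_le_of_forall_ge (P : Measure Ω) [IsProbabilityMeasure P]
    {A : Set Ω} (hA : MeasurableSet A) (hEmeas : ∀ i, MeasurableSet (E i))
    (hEdisj : Pairwise (Function.onFun Disjoint E)) (hEcover : (⋃ i, E i) = Set.univ)
    (hEpos : ∀ i, 0 < P (E i)) (h : ∀ i, (P A).toReal ≤ condProb P A (E i)) (i : I) :
    condProb P A (E i) ≤ (P A).toReal := by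
  have hpos (j : I) : 0 < (P (E j)).toReal :=
    ENNReal.toReal_pos (hEpos j).ne' (measure_ne_top P _)
  by_contra! hi
  exact lt_irrefl _ (hasSum_lt (fun j => (le_div_iff₀ (hpos j)).1 (h j))
    ((lt_div_iff₀ (hpos i)).1 hi)
    (hasSum_mul_toReal_measure_partition P hEmeas hEdisj hEcover _)
    (hasSum_toReal_measure_inter_partition P hA hEmeas hEdisj hEcover))

theorem le_condProb_of_forall_le (P : Measure Ω) [IsProbabilityMeasure P]
    {A : Set Ω} (hA : MeasurableSet A) (hEmeas : ∀ i, MeasurableSet (E i))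
    (hEdisj : Pairwise (Function.onFun Disjoint E)) (hEcover : (⋃ i, E i) = Set.univ)
    (hEpos : ∀ i, 0 < P (E i)) (h : ∀ i, condProb P A (E i) ≤ (P A).toReal) (i : I) :
    (P A).toReal ≤ condProb P A (E i) := by
  have hpos (j : I) : 0 < (P (E j)).toReal :=
    ENNReal.toReal_pos (hEpos j).ne' (measure_ne_top P _)
  by_contra! hi
  exact lt_irrefl _ (hasSum_lt (fun j => (div_le_iff₀ (hpos j)).1 (h j))
    ((div_lt_iff₀ (hpos i)).1 hi)
    (hasSum_toReal_measure_inter_partition P hA hEmeas hEdisj hEcover)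
    (hasSum_mul_toReal_measure_partition P hEmeas hEdisj hEcover _))

end Partition

/-- if the lower and upper probabilities of `A` are attained by elements of
`Ps`, then it is not the case that generalized Bayes' updating weakly constricts `A` on
every cell of a countable measurable partition; i.e. there is a cell on which it does not
weakly constrict `A`. -/
theorem exists_cell_not_weakly_constricting {Ω : Type*} [MeasurableSpace Ω]
    (Ps : Set (Measure Ω)) (hPsne : Ps.Nonempty)
    (hPsprob : ∀ P ∈ Ps, IsProbabilityMeasure P)
    {A : Set Ω} (hA : MeasurableSet A)
    {I : Type*} [Countable I] (E : I → Set Ω)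
    (hEmeas : ∀ i, MeasurableSet (E i))
    (hEdisj : Pairwise (Function.onFun Disjoint E))
    (hEcover : (⋃ i, E i) = Set.univ)
    (hEpos : ∀ P ∈ Ps, ∀ i, 0 < P (E i))
    (hlow : ∃ P₀ ∈ Ps, (P₀ A).toReal = lowerProb Ps A)
    (hup : ∃ P₁ ∈ Ps, (P₁ A).toReal = upperProb Ps A) :
    ¬ (∀ i : I,
        lowerProb Ps A ≤ (⨅ P : Ps, condProb P.1 A (E i)) ∧
        (⨆ P : Ps, condProb P.1 A (E i)) ≤ upperProb Ps A ∧
        (lowerProb Ps A < (⨅ P : Ps, condProb P.1 A (E i)) ∨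
          (⨆ P : Ps, condProb P.1 A (E i)) < upperProb Ps A)) := by
  intro h
  obtain ⟨P₀, hP₀, hl⟩ := hlow
  obtain ⟨P₁, hP₁, hu⟩ := hup
  have := hPsprob P₀ hP₀
  have := hPsprob P₁ hP₁
  obtain ⟨ω⟩ := P₀.nonempty_of_neZero
  obtain ⟨i, -⟩ := Set.mem_iUnion.1 (hEcover ▸ Set.mem_univ ω)
  have iInf_le₀ (j : I) : (⨅ P : Ps, condProb P.1 A (E j)) ≤ condProb P₀ A (E j) :=
    ciInf_le (f := fun P : Ps => condProb P.1 A (E j))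
      ⟨0, by rintro _ ⟨P, rfl⟩; exact condProb_nonneg _ _ _⟩ ⟨P₀, hP₀⟩
  have le_iSup₁ (j : I) : condProb P₁ A (E j) ≤ ⨆ P : Ps, condProb P.1 A (E j) :=
    le_ciSup (f := fun P : Ps => condProb P.1 A (E j))
      ⟨1, by
        rintro _ ⟨P, rfl⟩
        have := hPsprob P.1 P.2
        exact condProb_le_one _ _ _⟩ ⟨P₁, hP₁⟩
  have h₀ := condProb_le_of_forall_ge P₀ hA hEmeas hEdisj hEcover (hEpos P₀ hP₀)
    (fun j => hl.le.trans ((h j).1.trans (iInf_le₀ j))) i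
  have h₁ := le_condProb_of_forall_le P₁ hA hEmeas hEdisj hEcover (hEpos P₁ hP₁)
    (fun j => ((le_iSup₁ j).trans (h j).2.1).trans hu.ge) i
  rcases (h i).2.2 with hlt | hlt
  · exact (hlt.trans_le ((iInf_le₀ i).trans (h₀.trans hl.le))).false
  · exact (hlt.trans_le (hu.ge.trans (h₁.trans (le_iSup₁ i)))).false
end

section
/- Let Ω be a finite nonempty set, let m be a mass function on Ω, let E ⊆ Ω, and let f be a transfer function for E. Then the GGI-updated set function m^I(A) := Σ_{X⊆Ω} f(A,X)·m(X) is itself a mass function on Ω: m^I(A) ≥ 0 for all A ⊆ Ω, m^I(∅) = 0, and Σ_{A⊆Ω} m^I(A) = 1. -/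
open Finset

/-- The GGI-updated mass function `m^I A = ∑_X f A X * m X`. -/
def ggiMass {Ω : Type*} [Fintype Ω] [DecidableEq Ω]
    (f : Finset Ω → Finset Ω → ℝ) (m : Finset Ω → ℝ) (A : Finset Ω) : ℝ :=
  ∑ X : Finset Ω, f A X * m X

/-- if `m` is a mass function on a finite nonempty set `Ω` and `f` is a
transfer function for evidence `E`, then the GGI-updated set function
`m^I A = ∑_X f A X * m X` is itself a mass function: it is nonnegative, vanishes on `∅`,
and sums to `1` over all subsets of `Ω`. -/
theorem ggiMass_isMassFunction {Ω : Type*} [Fintype Ω] [DecidableEq Ω] [Nonempty Ω]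
    (m : Finset Ω → ℝ)
    (hm_nonneg : ∀ B, 0 ≤ m B) (hm_empty : m ∅ = 0)
    (hm_sum : ∑ B : Finset Ω, m B = 1)
    (E : Finset Ω)
    (f : Finset Ω → Finset Ω → ℝ)
    (hf_nonneg : ∀ B X, 0 ≤ f B X)
    (hf_sum : ∀ X, ∑ B : Finset Ω, f B X = 1)
    (hf_closed : ∀ B X, B ⊆ Eᶜ → f B X = 0)
    (hf_empty : ∀ X, f ∅ X = 0) :
    (∀ A : Finset Ω, 0 ≤ ggiMass f m A) ∧
      ggiMass f m ∅ = 0 ∧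
      ∑ A : Finset Ω, ggiMass f m A = 1 := by
  refine ⟨fun A => sum_nonneg fun X _ => mul_nonneg (hf_nonneg A X) (hm_nonneg X), ?_, ?_⟩
  · simp [ggiMass, hf_empty]
  · simp only [ggiMass]
    rw [sum_comm]
    simp only [← sum_mul, hf_sum, one_mul, hm_sum]
end

section
/- Let Ω be a nonempty set, let A_1, …, A_n ⊆ Ω, and let p ∈ ℝⁿ be a coherent assessment for (A_1, …, A_n). Let A_{n+1} ⊆ Ω be a further event. Then the set C := {x ∈ ℝ : the assessment (p_1, …, p_n, x) for (A_1, …, A_n, A_{n+1}) is coherent} is nonempty, closed, and convex; that is, C is a nonempty closed interval [p′, p″]. -/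
/-- De Finetti coherence of an assessment `q` on events `A 1, …, A m`: for every vector of
stakes `c`, `sup_ω ∑ i, c i * (1_{A i}(ω) − q i) ≥ 0`. -/
def Coherent {Ω : Type*} {m : ℕ} (A : Fin m → Set Ω) (q : Fin m → ℝ) : Prop :=
  ∀ c : Fin m → ℝ,
    0 ≤ ⨆ ω : Ω, ∑ i, c i * ((A i).indicator (fun _ => (1 : ℝ)) ω - q i)

/-- The vertex `(1_{A 1}(ω), …, 1_{A m}(ω))` determined by the outcome `ω`. -/
noncomputable def indicatorVector {Ω : Type*} {m : ℕ} (A : Fin m → Set Ω) (ω : Ω) : Fin m → ℝ :=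
  fun i => (A i).indicator (fun _ => (1 : ℝ)) ω

theorem finite_range_indicatorVector {Ω : Type*} {m : ℕ} (A : Fin m → Set Ω) :
    (Set.range (indicatorVector A)).Finite := by
  refine (Set.Finite.pi' (t := fun _ : Fin m => ({0, 1} : Set ℝ))
    fun _ => Set.toFinite _).subset ?_
  rintro _ ⟨ω, rfl⟩ i
  by_cases h : ω ∈ A i <;> simp [indicatorVector, h]

/-- An assessment is coherent iff it is a convex combination of indicator vectors. -/
theorem coherent_iff_mem_convexHull {Ω : Type*} [Nonempty Ω] {m : ℕ} (A : Fin m → Set Ω)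
    (q : Fin m → ℝ) :
    Coherent A q ↔ q ∈ convexHull ℝ (Set.range (indicatorVector A)) := by
  have hfin := finite_range_indicatorVector A
  constructor
  · intro hq
    by_contra hmem
    obtain ⟨f, u, hf, hu⟩ := geometric_hahn_banach_closed_point (convex_convexHull ℝ _)
      (hfin.isClosed_convexHull ℝ) hmem
    have key : ∀ v : Fin m → ℝ, f v = ∑ i, f (Pi.single i 1) * v i := by
      intro v
      conv_lhs => rw [pi_eq_sum_univ' v]
      rw [map_sum]
      refine Finset.sum_congr rfl fun i _ => ?_
      rw [map_smul, smul_eq_mul, mul_comm]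
    have hle : (⨆ ω : Ω, ∑ i, f (Pi.single i 1) *
        ((A i).indicator (fun _ => (1 : ℝ)) ω - q i)) ≤ u - f q := by
      refine ciSup_le fun ω => ?_
      have h1 := hf _ (subset_convexHull ℝ _ (Set.mem_range_self ω))
      have h2 := key (indicatorVector A ω - q)
      rw [map_sub] at h2
      change ∑ i, f (Pi.single i 1) * (indicatorVector A ω - q) i ≤ u - f q
      linarith
    have := hq fun i => f (Pi.single i 1)
    linarith
  · intro hq c
    let l : (Fin m → ℝ) →ₗ[ℝ] ℝ := ∑ i, c i • LinearMap.proj i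
    have hl : ∀ v, l v = ∑ i, c i * v i := fun v => by simp [l]
    have hsum : ∀ ω, ∑ i, c i * ((A i).indicator (fun _ => (1 : ℝ)) ω - q i) =
        l (indicatorVector A ω) - l q := fun ω => by
      rw [← map_sub, hl]; rfl
    simp only [hsum]
    have hbdd : BddAbove (Set.range fun ω => l (indicatorVector A ω) - l q) := by
      have := (hfin.image fun v => l v - l q).bddAbove
      rwa [← Set.range_comp] at this
    set s := ⨆ ω, (l (indicatorVector A ω) - l q)
    have hsub : convexHull ℝ (Set.range (indicatorVector A)) ⊆ {v | l v ≤ s + l q} := by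
      refine convexHull_min ?_ (convex_halfSpace_le l.isLinear _)
      rintro _ ⟨ω, rfl⟩
      exact sub_le_iff_le_add.1 (le_ciSup hbdd ω)
    have : l q ≤ s + l q := hsub hq
    linarith

/-- de Finetti's Fundamental Theorem of Probability: given a coherent
assessment `p` for events `A 1, …, A n` and a further event `A'`, the set of values `x` such
that the extended assessment `(p, x)` for `(A, A')` is coherent is a nonempty closed interval
`[p', p'']`: it is nonempty, closed and convex. -/
theorem deFinetti_fundamental_theorem {Ω : Type*} [Nonempty Ω] {n : ℕ}
    (A : Fin n → Set Ω) (p : Fin n → ℝ) (hp : Coherent A p) (A' : Set Ω) :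
    ({x : ℝ | Coherent (Fin.snoc A A') (Fin.snoc p x)}).Nonempty ∧
    IsClosed {x : ℝ | Coherent (Fin.snoc A A') (Fin.snoc p x)} ∧
    Convex ℝ {x : ℝ | Coherent (Fin.snoc A A') (Fin.snoc p x)} ∧
    ∃ p' p'' : ℝ, p' ≤ p'' ∧
      {x : ℝ | Coherent (Fin.snoc A A') (Fin.snoc p x)} = Set.Icc p' p'' := by
  let H := convexHull ℝ (Set.range (indicatorVector (Fin.snoc A A' : Fin (n + 1) → Set Ω)))
  let init : (Fin (n + 1) → ℝ) →ₗ[ℝ] (Fin n → ℝ) := LinearMap.funLeft ℝ ℝ Fin.castSucc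
  let last : (Fin (n + 1) → ℝ) →ₗ[ℝ] ℝ := LinearMap.proj (Fin.last n)
  have himage : {x : ℝ | Coherent (Fin.snoc A A') (Fin.snoc p x)} =
      last '' (H ∩ init ⁻¹' {p}) := by
    ext x
    rw [Set.mem_ofPred_eq, coherent_iff_mem_convexHull]
    constructor
    · refine fun hx => ⟨Fin.snoc p x, ⟨hx, ?_⟩, ?_⟩
      · ext i
        simp [init, LinearMap.funLeft_apply]
      · simp [last]
    · rintro ⟨v, ⟨hv, hvp⟩, rfl⟩
      convert hv
      rw [← Set.mem_singleton_iff.1 hvp]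
      exact Fin.snoc_init_self v
  have hinit : init '' H = convexHull ℝ (Set.range (indicatorVector A)) := by
    rw [init.image_convexHull, ← Set.range_comp]
    congr 2
    ext ω i
    simp [init, indicatorVector, LinearMap.funLeft_apply]
  have hne : ({x : ℝ | Coherent (Fin.snoc A A') (Fin.snoc p x)}).Nonempty := by
    rw [coherent_iff_mem_convexHull, ← hinit] at hp
    obtain ⟨v, hv, hvp⟩ := hp
    rw [himage]
    exact ⟨_, v, ⟨hv, hvp⟩, rfl⟩
  have hcompact : IsCompact {x : ℝ | Coherent (Fin.snoc A A') (Fin.snoc p x)} := by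
    rw [himage]
    exact (((finite_range_indicatorVector _).isCompact_convexHull ℝ).inter_right
      (isClosed_singleton.preimage init.continuous_of_finiteDimensional)).image
        last.continuous_of_finiteDimensional
  have hconvex : Convex ℝ {x : ℝ | Coherent (Fin.snoc A A') (Fin.snoc p x)} := by
    rw [himage]
    exact ((convex_convexHull ℝ _).inter
      ((convex_singleton p).linear_preimage init)).linear_image last
  have hIcc := eq_Icc_of_connected_compact ⟨hne, hconvex.isPreconnected⟩ hcompact
  refine ⟨hne, hcompact.isClosed, hconvex, _, _, ?_, hIcc⟩
  exact Set.nonempty_Icc.1 (hIcc ▸ hne)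
end

section
/- Let M be a k×k real matrix that is row-stochastic (all entries nonnegative and each row sums to 1). If there exists n ≥ 1 such that some column of Mⁿ has all entries strictly positive, then there exists a unique vector π ∈ ℝᵏ with π_j ≥ 0 for all j, Σ_j π_j = 1, and πᵀM = πᵀ; moreover the powers of M converge entrywise to the rank-one matrix with all rows equal to π, i.e., for all i, j, (M^m)_{ij} → π_j as m → ∞. (DeGroot's consensus theorem: the group reaches a consensus.) -/
open Filter

namespace Matrix

variable {ι : Type*} [Fintype ι]

/-- If every entry of the column `j₀` of a row-stochastic matrix is at least `δ`, then the matrix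
contracts the `ℓ¹` norm of row vectors with zero sum by the factor `1 - δ`. -/
theorem sum_abs_vecMul_le_of_le_col [DecidableEq ι] {P : Matrix ι ι ℝ}
    (hP : P ∈ rowStochastic ℝ ι) {δ : ℝ} {j₀ : ι} (hδ : ∀ i, δ ≤ P i j₀)
    {v : ι → ℝ} (hv : ∑ i, v i = 0) :
    ∑ j, |(v ᵥ* P) j| ≤ (1 - δ) * ∑ i, |v i| := by
  set Q : ι → ι → ℝ := fun i j => P i j - if j = j₀ then δ else 0 with hQ
  have hQ_nonneg : ∀ i j, 0 ≤ Q i j := by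
    intro i j
    by_cases h : j = j₀
    · simpa [hQ, h] using hδ i
    · simpa [hQ, h] using nonneg_of_mem_rowStochastic hP
  have hQ_sum : ∀ i, ∑ j, Q i j = 1 - δ := fun i => by
    simp [hQ, Finset.sum_sub_distrib, sum_row_of_mem_rowStochastic hP i]
  have hvQ : ∀ j, (v ᵥ* P) j = ∑ i, v i * Q i j := fun j => by
    simp only [hQ, mul_sub, Finset.sum_sub_distrib, ← Finset.sum_mul, hv, zero_mul, sub_zero]
    rfl
  calc ∑ j, |(v ᵥ* P) j| ≤ ∑ j, ∑ i, |v i| * Q i j := by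
        refine Finset.sum_le_sum fun j _ => ?_
        rw [hvQ]
        refine (Finset.abs_sum_le_sum_abs _ _).trans_eq (Finset.sum_congr rfl fun i _ => ?_)
        rw [abs_mul, abs_of_nonneg (hQ_nonneg i j)]
    _ = (1 - δ) * ∑ i, |v i| := by
        rw [Finset.sum_comm, Finset.mul_sum]
        refine Finset.sum_congr rfl fun i _ => ?_
        rw [← Finset.mul_sum, hQ_sum, mul_comm]

theorem sum_vecMul_of_mem_rowStochastic [DecidableEq ι] {P : Matrix ι ι ℝ}
    (hP : P ∈ rowStochastic ℝ ι) (v : ι → ℝ) : ∑ j, (v ᵥ* P) j = ∑ i, v i := by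
  simp only [vecMul, dotProduct]
  rw [Finset.sum_comm]
  simp [← Finset.mul_sum, sum_row_of_mem_rowStochastic hP]

/-- If some power of a row-stochastic matrix has a positive column, then its powers send every
row vector with zero sum to zero in the limit. -/
theorem tendsto_vecMul_pow_zero_of_pos_col [DecidableEq ι] {M : Matrix ι ι ℝ}
    (hM : M ∈ rowStochastic ℝ ι) {n : ℕ} {j₀ : ι} (hpos : ∀ i, 0 < (M ^ n) i j₀)
    {v : ι → ℝ} (hv : ∑ i, v i = 0) (j : ι) :
    Tendsto (fun m : ℕ => (v ᵥ* M ^ m) j) atTop (nhds 0) := by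
  have : Nonempty ι := ⟨j₀⟩
  obtain ⟨i₀, hi₀⟩ := Finite.exists_min fun i => (M ^ n) i j₀
  set a : ℕ → ℝ := fun m => ∑ j, |(v ᵥ* M ^ m) j| with ha
  have hsum : ∀ m, ∑ j, (v ᵥ* M ^ m) j = 0 := fun m => by
    rw [sum_vecMul_of_mem_rowStochastic (pow_mem hM m), hv]
  have ha_nonneg : ∀ m, 0 ≤ a m := fun m => Finset.sum_nonneg fun _ _ => abs_nonneg _
  have ha_anti : Antitone a := antitone_nat_of_succ_le fun m => by
    have h := sum_abs_vecMul_le_of_le_col hM (δ := 0) (j₀ := j₀)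
      (fun i => nonneg_of_mem_rowStochastic hM) (hsum m)
    simpa only [ha, pow_succ, ← vecMul_vecMul, sub_zero, one_mul] using h
  have ha_contr : ∀ m, a (m + n) ≤ (1 - (M ^ n) i₀ j₀) * a m := fun m => by
    have h := sum_abs_vecMul_le_of_le_col (pow_mem hM n) hi₀ (hsum m)
    simpa only [ha, pow_add, ← vecMul_vecMul] using h
  have ha_lim : Tendsto a atTop (nhds (⨅ m, a m)) :=
    tendsto_atTop_ciInf ha_anti ⟨0, by rintro _ ⟨m, rfl⟩; exact ha_nonneg m⟩
  have h_zero : ⨅ m, a m = 0 := by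
    have h_le := le_of_tendsto_of_tendsto' (ha_lim.comp (tendsto_add_atTop_nat n))
      (ha_lim.const_mul (1 - (M ^ n) i₀ j₀)) ha_contr
    have h_ge : 0 ≤ ⨅ m, a m := le_ciInf ha_nonneg
    nlinarith [hpos i₀]
  rw [h_zero] at ha_lim
  refine squeeze_zero_norm (fun m => ?_) ha_lim
  exact Finset.single_le_sum (f := fun j => |(v ᵥ* M ^ m) j|) (fun _ _ => abs_nonneg _)
    (Finset.mem_univ j)

theorem vecMul_pow_of_vecMul_eq [DecidableEq ι] {M : Matrix ι ι ℝ} {v : ι → ℝ}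
    (hv : v ᵥ* M = v) (m : ℕ) : v ᵥ* M ^ m = v := by
  induction m with
  | zero => simp
  | succ m ih => rw [pow_succ, ← vecMul_vecMul, ih, hv]

/-- Under the same positivity assumption, a left fixed vector with zero sum vanishes. -/
theorem eq_zero_of_vecMul_eq_of_pos_col [DecidableEq ι] {M : Matrix ι ι ℝ}
    (hM : M ∈ rowStochastic ℝ ι) {n : ℕ} {j₀ : ι} (hpos : ∀ i, 0 < (M ^ n) i j₀)
    {v : ι → ℝ} (hv : ∑ i, v i = 0) (hfix : v ᵥ* M = v) : v = 0 := by
  ext j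
  have h := tendsto_vecMul_pow_zero_of_pos_col hM hpos hv j
  simp only [vecMul_pow_of_vecMul_eq hfix] at h
  exact tendsto_nhds_unique tendsto_const_nhds h

/-- Under the same positivity assumption, there is a left fixed vector with sum one. -/
theorem exists_vecMul_eq_sum_eq_one_of_pos_col [DecidableEq ι] {M : Matrix ι ι ℝ}
    (hM : M ∈ rowStochastic ℝ ι) {n : ℕ} {j₀ : ι} (hpos : ∀ i, 0 < (M ^ n) i j₀) :
    ∃ w : ι → ℝ, ∑ i, w i = 1 ∧ w ᵥ* M = w := by
  have h_det : (M - 1).det = 0 := by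
    refine exists_mulVec_eq_zero_iff.1 ⟨1, fun h => one_ne_zero (congrFun h j₀), ?_⟩
    rw [sub_mulVec, one_vecMul_of_mem_rowStochastic hM, one_mulVec, sub_self]
  obtain ⟨v, hv_ne, hv⟩ := exists_vecMul_eq_zero_iff.2 h_det
  have hfix : v ᵥ* M = v := by rwa [vecMul_sub, vecMul_one, sub_eq_zero] at hv
  have hsum : ∑ i, v i ≠ 0 := fun h => hv_ne (eq_zero_of_vecMul_eq_of_pos_col hM hpos h hfix)
  refine ⟨(∑ i, v i)⁻¹ • v, ?_, by rw [smul_vecMul, hfix]⟩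
  simp [← Finset.mul_sum, hsum]

end Matrix

/-- DeGroot's consensus theorem: if `M` is a `k × k` row-stochastic matrix
and some power `Mⁿ` (`n ≥ 1`) has a column with all entries strictly positive, then there is
a unique probability vector `π` with `πᵀM = πᵀ`, and the powers of `M` converge entrywise to
the rank-one matrix all of whose rows equal `π`. -/
theorem degroot_consensus {k : ℕ} (M : Matrix (Fin k) (Fin k) ℝ)
    (hnonneg : ∀ i j, 0 ≤ M i j) (hrow : ∀ i, ∑ j, M i j = 1)
    (hpos : ∃ n : ℕ, 1 ≤ n ∧ ∃ j, ∀ i, 0 < (M ^ n) i j) :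
    ∃ π : Fin k → ℝ,
      ((∀ j, 0 ≤ π j) ∧ (∑ j, π j = 1) ∧ Matrix.vecMul π M = π ∧
        ∀ i j, Tendsto (fun m : ℕ => (M ^ m) i j) atTop (nhds (π j))) ∧
      ∀ π' : Fin k → ℝ,
        ((∀ j, 0 ≤ π' j) ∧ (∑ j, π' j = 1) ∧ Matrix.vecMul π' M = π') → π' = π := by
  obtain ⟨n, -, j₀, hpos⟩ := hpos
  have hM : M ∈ Matrix.rowStochastic ℝ (Fin k) :=
    Matrix.mem_rowStochastic_iff_sum.2 ⟨hnonneg, hrow⟩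
  obtain ⟨w, hw_sum, hw_fix⟩ := Matrix.exists_vecMul_eq_sum_eq_one_of_pos_col hM hpos
  have h_lim : ∀ i j, Tendsto (fun m : ℕ => (M ^ m) i j) atTop (nhds (w j)) := by
    intro i j
    have h_sum : ∑ l, (Pi.single i 1 - w : Fin k → ℝ) l = 0 := by
      simp [Finset.sum_sub_distrib, hw_sum]
    have h := (Matrix.tendsto_vecMul_pow_zero_of_pos_col hM hpos h_sum j).add_const (w j)
    simpa [Matrix.sub_vecMul, Matrix.vecMul_pow_of_vecMul_eq hw_fix] using h
  refine ⟨w, ⟨fun j => ?_, hw_sum, hw_fix, h_lim⟩, ?_⟩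
  · exact ge_of_tendsto' (h_lim j₀ j) fun m =>
      Matrix.nonneg_of_mem_rowStochastic (pow_mem hM m)
  · rintro π' ⟨-, hπ_sum, hπ_fix⟩
    refine sub_eq_zero.1 (Matrix.eq_zero_of_vecMul_eq_of_pos_col hM hpos ?_ ?_)
    · simp [Finset.sum_sub_distrib, hπ_sum, hw_sum]
    · rw [Matrix.sub_vecMul, hπ_fix, hw_fix]
end
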